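/- arXiv:2602.19256 — 3 statements merged into one kernel-verified Lean document; each statement's English description precedes it below -/
import Mathlib

section
/- Let X be a regular curve and f : X → X a continuous map. Then the polynomial entropy of f satisfies h_pol(f) ≤ 1 + limsup_{n→∞} log φ(f,n) / log n. -/
open Filter Topology TopologicalSpace Set
open scoped ENNReal NNReal

variable {X : Type*}

/-- The dynamical (Bowen) distance `d_n^f(x,y) = max_{0 ≤ k ≤ n-1} d(f^k x, f^k y)`. -/
noncomputable def dynDist [PseudoMetricSpace X] (f : X → X) (n : ℕ) (x y : X) : ℝ :=
  (((Finset.range n).sup fun k => nndist (f^[k] x) (f^[k] y) : ℝ≥0) : ℝ)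

/-- `E` is `(n, ε)`-separated for `f`: distinct points of `E` are at `d_n^f`-distance `≥ ε`. -/
def IsDynSeparated [PseudoMetricSpace X] (f : X → X) (n : ℕ) (ε : ℝ) (E : Set X) : Prop :=
  ∀ x ∈ E, ∀ y ∈ E, x ≠ y → ε ≤ dynDist f n x y

/-- `sep(n, ε)`: the maximal cardinality of a finite `(n, ε)`-separated set. -/
noncomputable def sepCount [PseudoMetricSpace X] (f : X → X) (n : ℕ) (ε : ℝ) : ℕ∞ :=
  ⨆ (E : Finset X) (_ : IsDynSeparated f n ε (E : Set X)), (E.card : ℕ∞)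

/-- `limsup_{n → ∞} log (u n) / log n`, valued in `[0, ∞]`. -/
noncomputable def polGrowth (u : ℕ → ℕ∞) : ℝ≥0∞ :=
  Filter.atTop.limsup fun n =>
    if u n = ⊤ then ⊤ else ENNReal.ofReal (Real.log ((u n).toNat : ℝ) / Real.log n)

/-- Polynomial entropy: `lim_{ε → 0⁺} limsup_{n → ∞} log sep(n,ε) / log n`; since the inner
quantity is antitone in `ε`, the limit as `ε → 0⁺` equals the supremum over `ε > 0`. -/
noncomputable def hpol [PseudoMetricSpace X] (f : X → X) : ℝ≥0∞ :=
  ⨆ (ε : ℝ) (_ : 0 < ε), polGrowth fun n => sepCount f n ε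

/-- The regularity condition for a regular curve: every point has arbitrarily small open
neighbourhoods with finite topological boundary. (The requirement that `X` be a continuum,
i.e. a nonempty compact connected metric space, is imposed via instance arguments.) -/
def IsRegularCurve (X : Type*) [TopologicalSpace X] : Prop :=
  ∀ x : X, ∀ U : Set X, IsOpen U → x ∈ U →
    ∃ V : Set X, IsOpen V ∧ x ∈ V ∧ V ⊆ U ∧ (frontier V).Finite

/-- `φ(f, n)`: the supremum over `x ∈ X` of the number of connected components of the
preimage `f^{-n}({x})`. -/
noncomputable def compCount [TopologicalSpace X] (f : X → X) (n : ℕ) : ℕ∞ :=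
  ⨆ x : X, ENat.card (ConnectedComponents (f^[n] ⁻¹' {x} : Set X))

/-- A regular curve carries, at every scale, a finite set `F` and closed cells `Q z ∋ z` of small
radius which are open away from `F`. -/
theorem IsRegularCurve.exists_finite_cells [MetricSpace X] [CompactSpace X]
    (hX : IsRegularCurve X) {ε : ℝ} (hε : 0 < ε) :
    ∃ (F : Finset X) (Q : X → Set X), (∀ z, IsClosed (Q z)) ∧ (∀ z, z ∈ Q z) ∧
      (∀ z, ∀ w ∈ Q z, dist w z ≤ ε) ∧ ∀ z, IsOpen (Q z \ F) := by
  classical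
  choose V hVo hxV hVsub hVfin using fun x : X =>
    hX x (Metric.ball x (ε / 2)) Metric.isOpen_ball (Metric.mem_ball_self (half_pos hε))
  obtain ⟨t, ht⟩ := isCompact_univ.elim_finite_subcover V hVo
    fun x _ => Set.mem_iUnion.2 ⟨x, hxV x⟩
  have hmem : ∀ x w, x ∈ t →
      w ∉ (t.biUnion fun i => (hVfin i).toFinset : Finset X) → w ∉ frontier (V x) := by
    intro x w hx hw hwf
    exact hw (Finset.mem_biUnion.2 ⟨x, hx, (hVfin x).mem_toFinset.2 hwf⟩)
  refine ⟨t.biUnion fun i => (hVfin i).toFinset,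
    fun z => ⋂ i ∈ t, if z ∈ V i then closure (V i) else (V i)ᶜ, ?_, ?_, ?_, ?_⟩
  · intro z
    refine isClosed_biInter fun i _ => ?_
    split_ifs
    exacts [isClosed_closure, (hVo i).isClosed_compl]
  · intro z
    refine Set.mem_iInter₂.2 fun i _ => ?_
    split_ifs with h
    exacts [subset_closure h, h]
  · intro z w hw
    obtain ⟨i, hi, hzi⟩ := Set.mem_iUnion₂.1 (ht (Set.mem_univ z))
    have h1 := Set.mem_iInter₂.1 hw i hi
    rw [if_pos hzi] at h1
    have h2 : w ∈ Metric.closedBall i (ε / 2) :=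
      closure_minimal ((hVsub i).trans Metric.ball_subset_closedBall) Metric.isClosed_closedBall h1
    have h3 := hVsub i hzi
    rw [Metric.mem_closedBall] at h2
    rw [Metric.mem_ball, dist_comm] at h3
    linarith [dist_triangle w i z]
  · intro z
    have key : (⋂ i ∈ t, if z ∈ V i then closure (V i) else (V i)ᶜ) \
          (t.biUnion fun i => (hVfin i).toFinset : Finset X) =
        (⋂ i ∈ t, if z ∈ V i then V i else (closure (V i))ᶜ) \
          (t.biUnion fun i => (hVfin i).toFinset : Finset X) := by
      ext w
      refine and_congr_left fun hw => ?_
      simp only [Set.mem_iInter]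
      refine forall₂_congr fun i hi => ?_
      have hwf := hmem i w hi hw
      have hiff : w ∈ closure (V i) ↔ w ∈ V i := by
        rw [(hVo i).frontier_eq] at hwf
        exact ⟨fun h => by_contra fun h' => hwf ⟨h, h'⟩, fun h => subset_closure h⟩
      split_ifs <;> simp [hiff]
    rw [key]
    refine IsOpen.sdiff ?_ (Finset.finite_toSet _).isClosed
    refine isOpen_biInter_finset fun i _ => ?_
    split_ifs
    exacts [hVo i, isClosed_closure.isOpen_compl]

/-- A set with at most `M` connected components is met by a set of at most `M` points in every
component. -/
theorem exists_finset_card_le_meeting_components [TopologicalSpace X] (S : Set X) (M : ℕ)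
    (hS : ENat.card (ConnectedComponents S) ≤ M) :
    ∃ R : Finset X, R.card ≤ M ∧
      ∀ y ∈ S, ∃ s ∈ R, ∃ A ⊆ S, IsPreconnected A ∧ y ∈ A ∧ s ∈ A := by
  classical
  have hfin : Finite (ConnectedComponents S) :=
    ENat.card_lt_top.1 (hS.trans_lt (ENat.natCast_lt_top M))
  have := Fintype.ofFinite (ConnectedComponents S)
  refine ⟨Finset.univ.image fun c : ConnectedComponents S => ((Quotient.out c : S) : X),
    Finset.card_image_le.trans ?_, fun y hy => ?_⟩
  · rw [ENat.card_eq_coe_fintype_card] at hS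
    exact_mod_cast hS
  · let c : ConnectedComponents S := ConnectedComponents.mk ⟨y, hy⟩
    refine ⟨_, Finset.mem_image_of_mem _ (Finset.mem_univ c),
      Subtype.val '' connectedComponent (⟨y, hy⟩ : S), Subtype.coe_image_subset _ _,
      isPreconnected_connectedComponent.image _ continuous_subtype_val.continuousOn,
      ⟨_, mem_connectedComponent, rfl⟩, ⟨_, ?_, rfl⟩⟩
    exact ConnectedComponents.coe_eq_coe'.1 (Quotient.out_eq c)

/-- A preconnected set meeting the points whose orbit stays in closed cells `Q j` at the times
`j ∈ J` consists of such points, if these orbits avoid `F` and the cells are open off `F`. -/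
theorem IsPreconnected.forall_iterate_mem_of_forall_notMem [TopologicalSpace X] {f : X → X}
    (hf : Continuous f) {F A : Set X} {Q : ℕ → Set X} (hQ : ∀ j, IsClosed (Q j))
    (hQF : ∀ j, IsOpen (Q j \ F)) (J : Finset ℕ) (hA : IsPreconnected A)
    (havoid : ∀ z ∈ A, (∀ j ∈ J, f^[j] z ∈ Q j) → ∀ j ∈ J, f^[j] z ∉ F)
    {y : X} (hyA : y ∈ A) (hy : ∀ j ∈ J, f^[j] y ∈ Q j) {z : X} (hz : z ∈ A) :
    ∀ j ∈ J, f^[j] z ∈ Q j := by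
  have hO : IsOpen (⋂ j ∈ J, f^[j] ⁻¹' (Q j \ F)) :=
    isOpen_biInter_finset fun j _ => (hQF j).preimage (hf.iterate j)
  have hT : IsClosed (⋂ j ∈ J, f^[j] ⁻¹' Q j) :=
    isClosed_biInter fun j _ => (hQ j).preimage (hf.iterate j)
  have hsub : A ⊆ ⋂ j ∈ J, f^[j] ⁻¹' (Q j \ F) := by
    refine hA.subset_left_of_subset_union hO hT.isOpen_compl ?_ ?_ ⟨y, hyA, ?_⟩
    · refine Set.disjoint_left.2 fun w hw hw' => hw' ?_
      exact Set.mem_iInter₂.2 fun j hj => (Set.mem_iInter₂.1 hw j hj).1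
    · intro w hw
      by_cases h : ∀ j ∈ J, f^[j] w ∈ Q j
      · exact Or.inl (Set.mem_iInter₂.2 fun j hj => ⟨h j hj, havoid w hw h j hj⟩)
      · exact Or.inr fun h' => h fun j hj => Set.mem_iInter₂.1 h' j hj
    · exact Set.mem_iInter₂.2 fun j hj => ⟨hy j hj, havoid y hyA hy j hj⟩
  exact fun j hj => (Set.mem_iInter₂.1 (hsub hz) j hj).1

/-- If each `f^{-k}(x)` with `K ≤ k < n` has at most `M` components, then all itineraries in
the times `[K, n)` are realised, up to closure of cells, by `n * (|F| * M) + 1` points. -/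
theorem exists_finset_forall_iterate_mem_cell [TopologicalSpace X] [PreconnectedSpace X]
    [Nonempty X] {f : X → X} (hf : Continuous f) (F : Finset X) (Q : X → Set X)
    (hQ : ∀ z, IsClosed (Q z)) (hQs : ∀ z, z ∈ Q z) (hQF : ∀ z, IsOpen (Q z \ F))
    (K n M : ℕ) (hM : ∀ k, K ≤ k → k < n → compCount f k ≤ M) :
    ∃ R : Finset X, R.card ≤ n * (F.card * M) + 1 ∧
      ∀ x, ∃ s ∈ R, ∀ j ∈ Finset.Ico K n, f^[j] s ∈ Q (f^[j] x) := by
  classical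
  have hex : ∀ k ∈ Finset.Ico K n, ∀ p : X, ∃ R : Finset X, R.card ≤ M ∧
      ∀ y ∈ f^[k] ⁻¹' {p}, ∃ s ∈ R, ∃ A ⊆ f^[k] ⁻¹' {p},
        IsPreconnected A ∧ y ∈ A ∧ s ∈ A := by
    intro k hk p
    rw [Finset.mem_Ico] at hk
    exact exists_finset_card_le_meeting_components _ _
      ((le_iSup (fun x : X => ENat.card (ConnectedComponents (f^[k] ⁻¹' {x} : Set X))) p).trans
        (hM k hk.1 hk.2))
  choose! R hRcard hR using hex
  obtain ⟨x₀⟩ := ‹Nonempty X›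
  refine ⟨insert x₀ ((Finset.Ico K n).biUnion fun k => F.biUnion (R k)), ?_, fun x => ?_⟩
  · refine (Finset.card_insert_le _ _).trans (Nat.add_le_add_right ?_ 1)
    refine (Finset.card_biUnion_le_card_mul _ _ (F.card * M) fun k hk =>
      Finset.card_biUnion_le_card_mul _ _ M fun p _ => hRcard k hk p).trans ?_
    gcongr
    simp
  · by_cases hP : ∃ k, k ∈ Finset.Ico K n ∧
        ∃ y, (∀ j ∈ Finset.Ico K n, f^[j] y ∈ Q (f^[j] x)) ∧ f^[k] y ∈ F
    · obtain ⟨hk, y, hy, hyF⟩ := Nat.find_spec hP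
      have hmin := fun m => Nat.find_min (m := m) hP
      generalize Nat.find hP = k at hk hyF hmin
      obtain ⟨s, hs, A, hAsub, hA, hyA, hsA⟩ := hR k hk (f^[k] y) y rfl
      refine ⟨s, Finset.mem_insert_of_mem (Finset.mem_biUnion.2
        ⟨k, hk, Finset.mem_biUnion.2 ⟨_, hyF, hs⟩⟩), ?_⟩
      have hkn := Finset.mem_Ico.1 hk
      have hlate : ∀ z ∈ A, ∀ j ∈ Finset.Ico K n, k ≤ j → f^[j] z ∈ Q (f^[j] x) := by
        intro z hz j hj hkj
        have hzk : f^[k] z = f^[k] y := hAsub hz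
        have : f^[j] z = f^[j] y := by
          rw [← Nat.sub_add_cancel hkj, Function.iterate_add_apply, hzk,
            ← Function.iterate_add_apply]
        rw [this]
        exact hy j hj
      have hearly := hA.forall_iterate_mem_of_forall_notMem hf (F := (F : Set X))
        (Q := fun j => Q (f^[j] x)) (fun j => hQ _) (fun j => hQF _) (Finset.Ico K k)
        (fun z hz hzQ j hj hzF => by
          have hj' := Finset.mem_Ico.1 hj
          refine hmin j hj'.2 ⟨Finset.mem_Ico.2 ⟨hj'.1, hj'.2.trans hkn.2⟩, z, fun i hi => ?_, hzF⟩
          rcases lt_or_ge i k with h | h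
          · exact hzQ i (Finset.mem_Ico.2 ⟨(Finset.mem_Ico.1 hi).1, h⟩)
          · exact hlate z hz i hi h)
        hyA (fun j hj => hy j (Finset.Ico_subset_Ico_right hkn.2.le hj)) hsA
      intro j hj
      rcases lt_or_ge j k with h | h
      · exact hearly j (Finset.mem_Ico.2 ⟨(Finset.mem_Ico.1 hj).1, h⟩)
      · exact hlate s hsA j hj h
    · exact ⟨x₀, Finset.mem_insert_self _ _,
        isPreconnected_univ.forall_iterate_mem_of_forall_notMem hf (F := (F : Set X))
        (Q := fun j => Q (f^[j] x)) (fun j => hQ _) (fun j => hQF _) _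
        (fun z _ hz j hj hzF => hP ⟨j, hj, z, hz, hzF⟩) (Set.mem_univ x) (fun j _ => hQs _)
        (Set.mem_univ x₀)⟩

theorem dynDist_lt_iff [PseudoMetricSpace X] {f : X → X} {n : ℕ} {x y : X} {ε : ℝ} (hε : 0 < ε) :
    dynDist f n x y < ε ↔ ∀ k < n, dist (f^[k] x) (f^[k] y) < ε := by
  lift ε to ℝ≥0 using hε.le
  rw [dynDist, NNReal.coe_lt_coe, Finset.sup_lt_iff (by exact_mod_cast hε)]
  simp only [Finset.mem_range, ← NNReal.coe_lt_coe, coe_nndist]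

/-- A compact space is covered by finitely many sets that are small for `d_K^f`. -/
theorem exists_finset_forall_dist_iterate_lt [PseudoMetricSpace X] [CompactSpace X] {f : X → X}
    (hf : Continuous f) (K : ℕ) {ε : ℝ} (hε : 0 < ε) :
    ∃ R : Finset X, ∀ x, ∃ s ∈ R, ∀ k < K, dist (f^[k] x) (f^[k] s) < ε := by
  obtain ⟨t, ht⟩ := isCompact_univ.elim_finite_subcover
    (fun s : X => ⋂ k ∈ Finset.range K, {x | dist (f^[k] x) (f^[k] s) < ε})
    (fun s => isOpen_biInter_finset fun k _ =>
      isOpen_lt ((hf.iterate k).dist continuous_const) continuous_const)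
    (fun x _ => Set.mem_iUnion.2 ⟨x, by simpa using fun _ _ => hε⟩)
  refine ⟨t, fun x => ?_⟩
  obtain ⟨s, hs, hxs⟩ := Set.mem_iUnion₂.1 (ht (Set.mem_univ x))
  exact ⟨s, hs, by simpa using hxs⟩

/-- On a regular curve, `sep(n, ε)` is bounded linearly in `n` and in a bound for the numbers
of components of the preimages `f^{-k}(x)`, `K ≤ k < n`. -/
theorem IsRegularCurve.exists_sepCount_le [MetricSpace X] [CompactSpace X] [ConnectedSpace X]
    (hX : IsRegularCurve X) {f : X → X} (hf : Continuous f) {ε : ℝ} (hε : 0 < ε) (K : ℕ) :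
    ∃ N c : ℕ, ∀ n M : ℕ, (∀ k, K ≤ k → k < n → compCount f k ≤ M) →
      sepCount f n ε ≤ (N * (n * (c * M) + 1) : ℕ) := by
  obtain ⟨F, Q, hQ, hQs, hQd, hQF⟩ := hX.exists_finite_cells (ε := ε / 3) (by positivity)
  obtain ⟨R₀, hR₀⟩ := exists_finset_forall_dist_iterate_lt hf K (ε := ε / 3) (by positivity)
  refine ⟨R₀.card, F.card, fun n M hM => iSup₂_le fun E hE => ?_⟩
  obtain ⟨R, hRcard, hR⟩ := exists_finset_forall_iterate_mem_cell hf F Q hQ hQs hQF K n M hM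
  choose g₀ hg₀ hg₀d using hR₀
  choose g hg hgQ using hR
  have hinj : Set.InjOn (fun x => (g₀ x, g x)) (E : Set X) := by
    intro x hx y hy hxy
    by_contra hne
    refine (hE x hx y hy hne).not_gt ((dynDist_lt_iff hε).2 fun k hk => ?_)
    obtain ⟨h₀, h₁⟩ := Prod.mk.inj hxy
    rcases lt_or_ge k K with h | h
    · have hx' := hg₀d x k h
      have hy' := hg₀d y k h
      rw [← h₀] at hy'
      linarith [dist_triangle_right (f^[k] x) (f^[k] y) (f^[k] (g₀ x))]
    · have hx' := hQd _ _ (hgQ x k (Finset.mem_Ico.2 ⟨h, hk⟩))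
      have hy' := hQd _ _ (hgQ y k (Finset.mem_Ico.2 ⟨h, hk⟩))
      rw [← h₁] at hy'
      linarith [dist_triangle_left (f^[k] x) (f^[k] y) (f^[k] (g x))]
  have hcard := Finset.card_le_card_of_injOn (t := R₀ ×ˢ R) (fun x => (g₀ x, g x))
    (fun x _ => Finset.mem_coe.2 (Finset.mem_product.2 ⟨hg₀ x, hg x⟩)) hinj
  rw [Finset.card_product] at hcard
  exact_mod_cast hcard.trans (Nat.mul_le_mul_left _ hRcard)

/-- Polynomial growth of order less than `b` gives an eventual bound by `n ^ b`. -/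
theorem eventually_le_floor_rpow_of_polGrowth_lt {u : ℕ → ℕ∞} {b : ℝ≥0}
    (h : polGrowth u < b) : ∀ᶠ n : ℕ in atTop, u n ≤ (⌊(n : ℝ) ^ (b : ℝ)⌋₊ : ℕ) := by
  filter_upwards [Filter.eventually_lt_of_limsup_lt h, eventually_ge_atTop 2] with n hn hn2
  split_ifs at hn with htop
  · exact absurd hn not_top_lt
  · have hlog : 0 < Real.log n := Real.log_pos (by exact_mod_cast hn2)
    rw [← ENNReal.ofReal_coe_nnreal, ENNReal.ofReal_lt_ofReal_iff'] at hn
    have hle : Real.log ((u n).toNat : ℝ) ≤ b * Real.log n := ((div_lt_iff₀ hlog).1 hn.1).le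
    rw [← ENat.natCast_toNat htop, Nat.cast_le]
    refine Nat.le_floor ?_
    rcases Nat.eq_zero_or_pos (u n).toNat with h0 | h0
    · rw [h0, Nat.cast_zero]
      positivity
    · rwa [Real.le_rpow_iff_log_le (by exact_mod_cast h0) (by positivity)]

theorem polGrowth_le_of_eventually_le_rpow {u : ℕ → ℕ∞} {b : ℝ≥0} (C : ℝ)
    (h : ∀ᶠ n : ℕ in atTop, u n ≠ ⊤ ∧ ((u n).toNat : ℝ) ≤ C * (n : ℝ) ^ (b : ℝ)) :
    polGrowth u ≤ b := by
  refine ENNReal.le_of_forall_pos_le_add fun η hη _ => ?_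
  have hlim : Tendsto (fun n : ℕ => Real.log C / Real.log n) atTop (𝓝 0) :=
    (Real.tendsto_log_atTop.comp tendsto_natCast_atTop_atTop).const_div_atTop _
  refine Filter.limsup_le_of_le (by isBoundedDefault) ?_
  filter_upwards [h, hlim.eventually_lt_const (NNReal.coe_pos.2 hη), eventually_ge_atTop 2]
    with n ⟨htop, hn⟩ hsmall hn2
  have hlog : 0 < Real.log n := Real.log_pos (by exact_mod_cast hn2)
  have hn0 : (0 : ℝ) < n := by positivity
  rw [if_neg htop, ← ENNReal.coe_add, ← ENNReal.ofReal_coe_nnreal]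
  refine ENNReal.ofReal_le_ofReal ?_
  rw [NNReal.coe_add]
  rcases Nat.eq_zero_or_pos (u n).toNat with h0 | h0
  · rw [h0, Nat.cast_zero, Real.log_zero, zero_div]
    positivity
  · have hu : (0 : ℝ) < (u n).toNat := by exact_mod_cast h0
    have hpow : 0 < (n : ℝ) ^ (b : ℝ) := Real.rpow_pos_of_pos hn0 _
    have hC : 0 < C := pos_of_mul_pos_left (hu.trans_le hn) hpow.le
    have hle := Real.log_le_log hu hn
    rw [Real.log_mul hC.ne' hpow.ne', Real.log_rpow hn0] at hle
    rw [div_lt_iff₀ hlog] at hsmall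
    rw [div_le_iff₀ hlog]
    linarith

/-- for a continuous map `f` on a regular curve `X`,
`h_pol(f) ≤ 1 + limsup_{n→∞} log φ(f,n) / log n`. -/
theorem hpol_le_one_add_compCount_growth_of_isRegularCurve
    {X : Type*} [MetricSpace X] [CompactSpace X] [ConnectedSpace X] [Nonempty X]
    (hX : IsRegularCurve X) (f : X → X) (hf : Continuous f) :
    hpol f ≤ 1 + polGrowth (compCount f) := by
  refine iSup₂_le fun ε hε => ENNReal.le_of_forall_pos_le_add fun η hη hfin => ?_
  have htop : polGrowth (compCount f) ≠ ⊤ := fun h => by simp [h] at hfin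
  obtain ⟨b, hb⟩ : ∃ b : ℝ≥0, (b : ℝ≥0∞) = polGrowth (compCount f) + η :=
    ⟨_, ENNReal.coe_toNNReal (ENNReal.add_ne_top.2 ⟨htop, ENNReal.coe_ne_top⟩)⟩
  have hlt : polGrowth (compCount f) < b := by
    rw [hb]
    exact ENNReal.lt_add_right htop (by exact_mod_cast hη.ne')
  obtain ⟨K, hK⟩ := eventually_atTop.1 (eventually_le_floor_rpow_of_polGrowth_lt hlt)
  obtain ⟨N, c, hNc⟩ := hX.exists_sepCount_le hf hε K
  rw [add_assoc, ← hb, ← ENNReal.coe_one, ← ENNReal.coe_add]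
  refine polGrowth_le_of_eventually_le_rpow (N * (c + 1)) ?_
  filter_upwards [eventually_ge_atTop 1] with n hn
  have hn1 : (1 : ℝ) ≤ n := by exact_mod_cast hn
  have hsep := hNc n ⌊(n : ℝ) ^ (b : ℝ)⌋₊ fun k hKk hkn => (hK k hKk).trans (by
    norm_cast
    gcongr)
  refine ⟨(hsep.trans_lt (ENat.natCast_lt_top _)).ne, ?_⟩
  have hcast : ((sepCount f n ε).toNat : ℝ) ≤
      N * (n * (c * (⌊(n : ℝ) ^ (b : ℝ)⌋₊ : ℕ)) + 1) := by
    exact_mod_cast ENat.toNat_le_of_le_natCast hsep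
  have hpow : (n : ℝ) ^ ((1 + b : ℝ≥0) : ℝ) = n * (n : ℝ) ^ (b : ℝ) := by
    rw [NNReal.coe_add, NNReal.coe_one, Real.rpow_add (by positivity), Real.rpow_one]
  have hone : 1 ≤ (n : ℝ) * (n : ℝ) ^ (b : ℝ) := by
    rw [← hpow]
    exact Real.one_le_rpow hn1 (NNReal.coe_nonneg _)
  have hfloor := Nat.floor_le (a := (n : ℝ) ^ (b : ℝ)) (by positivity)
  calc ((sepCount f n ε).toNat : ℝ)
      ≤ N * (n * (c * (⌊(n : ℝ) ^ (b : ℝ)⌋₊ : ℕ)) + 1) := hcast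
    _ ≤ N * (n * (c * (n : ℝ) ^ (b : ℝ)) + n * (n : ℝ) ^ (b : ℝ)) := by gcongr
    _ = N * (c + 1) * (n : ℝ) ^ ((1 + b : ℝ≥0) : ℝ) := by rw [hpow]; ring
end

section
/- Let X be a regular curve and f : X → X a homeomorphism. Then the polynomial entropy of f satisfies h_pol(f) ≤ 1. -/
open Filter Topology TopologicalSpace Set
open scoped ENNReal NNReal

variable {X : Type*}

theorem polGrowth_le_one_of_le_mul {u : ℕ → ℕ∞} (C : ℕ)
    (hu : ∀ n, 0 < n → u n ≤ ((C * n : ℕ) : ℕ∞)) : polGrowth u ≤ 1 := by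
  have hlim : Tendsto (fun n : ℕ => ENNReal.ofReal (Real.log (C + 1) / Real.log n + 1))
      atTop (𝓝 1) := by
    have h1 : Tendsto (fun n : ℕ => Real.log (n : ℝ)) atTop atTop :=
      Real.tendsto_log_atTop.comp tendsto_natCast_atTop_atTop
    have h2 := (h1.const_div_atTop (Real.log (C + 1))).add_const 1
    simpa using ENNReal.tendsto_ofReal h2
  rw [← hlim.limsup_eq]
  refine Filter.limsup_le_limsup ?_
  filter_upwards [eventually_ge_atTop 2] with n hn
  have hun := hu n (by omega)
  have htop : u n ≠ ⊤ := ne_top_of_le_ne_top (ENat.natCast_ne_top _) hun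
  rw [if_neg htop]
  apply ENNReal.ofReal_le_ofReal
  have hnat : (u n).toNat ≤ C * n := by
    simpa using ENat.toNat_le_toNat hun (ENat.natCast_ne_top _)
  have hn' : (1 : ℝ) < n := by exact_mod_cast hn
  have hlogn : 0 < Real.log n := Real.log_pos hn'
  have hC : (0 : ℝ) ≤ C := Nat.cast_nonneg C
  rw [div_add_one hlogn.ne', ← Real.log_mul (by positivity) (by positivity)]
  refine div_le_div_of_nonneg_right ?_ hlogn.le
  rcases Nat.eq_zero_or_pos (u n).toNat with h0 | h0
  · rw [h0, Nat.cast_zero, Real.log_zero]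
    exact Real.log_nonneg (by nlinarith)
  · apply Real.log_le_log (by exact_mod_cast h0)
    have : ((u n).toNat : ℝ) ≤ C * n := by exact_mod_cast hnat
    nlinarith

theorem dynDist_lt [PseudoMetricSpace X] {f : X → X} {n : ℕ} {x y : X} {ε : ℝ} (hε : 0 < ε)
    (h : ∀ k < n, dist (f^[k] x) (f^[k] y) < ε) : dynDist f n x y < ε := by
  lift ε to ℝ≥0 using hε.le
  rw [dynDist, NNReal.coe_lt_coe, Finset.sup_lt_iff (by simpa using hε)]
  intro k hk
  rw [← NNReal.coe_lt_coe, coe_nndist]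
  exact h k (Finset.mem_range.1 hk)

/-- The points whose first `n` iterates under the injective map `f` meet the finite set `S`. -/
noncomputable def hittingPoints {f : X → X} (hf : Function.Injective f) (S : Finset X) (n : ℕ) :
    Finset X :=
  open Classical in
  (Finset.range n).biUnion fun k => S.preimage f^[k] (hf.iterate k).injOn

theorem mem_hittingPoints {f : X → X} (hf : Function.Injective f) {S : Finset X} {n : ℕ} {x : X} :
    x ∈ hittingPoints hf S n ↔ ∃ k < n, f^[k] x ∈ S := by
  simp [hittingPoints]

theorem card_hittingPoints_le {f : X → X} (hf : Function.Injective f) (S : Finset X) (n : ℕ) :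
    (hittingPoints hf S n).card ≤ n * S.card := by
  classical
  refine (Finset.card_biUnion_le_card_mul _ _ S.card fun k _ => ?_).trans (by simp)
  exact Finset.card_le_card_of_injOn f^[k] (fun x hx => by simpa using hx) (hf.iterate k).injOn

/-- The words of length `n` compatible with the code `c` along the orbit of `b`, the letters at
the times when the orbit visits `B` being arbitrary. -/
noncomputable def compatibleWords {α : Type*} [Fintype α] (f : X → X) (c : X → α) (B : Finset X)
    (n : ℕ) (b : X) : Finset (Fin n → α) :=
  open Classical in
  Fintype.piFinset fun k => if f^[k] b ∈ B then Finset.univ else {c (f^[k] b)}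

theorem mem_compatibleWords {α : Type*} [Fintype α] {f : X → X} {c : X → α} {B : Finset X}
    {n : ℕ} {b : X} {w : Fin n → α} :
    w ∈ compatibleWords f c B n b ↔ ∀ k : Fin n, f^[k] b ∉ B → w k = c (f^[k] b) := by
  classical
  rw [compatibleWords, Fintype.mem_piFinset]
  refine forall_congr' fun k => ?_
  by_cases h : f^[k] b ∈ B <;> simp [h]

theorem card_compatibleWords_le {α : Type*} [Fintype α] [Nonempty α] {f : X → X} (c : X → α)
    (B : Finset X) (n : ℕ) {b : X} (hb : Function.Injective fun k => f^[k] b) :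
    (compatibleWords f c B n b).card ≤ Fintype.card α ^ B.card := by
  classical
  have hprod : (compatibleWords f c B n b).card =
      Fintype.card α ^ (Finset.univ.filter fun k : Fin n => f^[k] b ∈ B).card := by
    rw [compatibleWords, Fintype.card_piFinset, ← Finset.prod_const, Finset.prod_filter]
    refine Finset.prod_congr rfl fun k _ => ?_
    split_ifs <;> simp
  rw [hprod]
  refine Nat.pow_le_pow_right Fintype.card_pos ?_
  refine Finset.card_le_card_of_injOn (fun k : Fin n => f^[k] b) (fun k hk => by simpa using hk) ?_
  exact (hb.comp Fin.val_injective).injOn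

/-- Outside a finite forward invariant set, every point whose orbit visits the finite set `B`
has an injective orbit. -/
theorem exists_finite_mapsTo_or_injective_iterate {f : X → X} (hf : Function.Injective f)
    (B : Finset X) :
    ∃ Q : Set X, Q.Finite ∧ MapsTo f Q Q ∧
      ∀ b, (∃ k, f^[k] b ∈ B) → b ∈ Q ∨ Function.Injective fun k => f^[k] b := by
  refine ⟨⋃ b ∈ (B : Set X) ∩ Function.periodicPts f, range fun j => f^[j] b, ?_, ?_, ?_⟩
  · refine Finite.biUnion (B.finite_toSet.inter_of_left _) fun b hb => ?_
    refine ((Finset.range (Function.minimalPeriod f b)).finite_toSet.image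
      fun j => f^[j] b).subset ?_
    rintro _ ⟨j, rfl⟩
    refine ⟨j % Function.minimalPeriod f b, ?_, Function.iterate_mod_minimalPeriod_eq⟩
    simpa using Nat.mod_lt _ (Function.minimalPeriod_pos_of_mem_periodicPts hb.2)
  · intro x hx
    simp only [mem_iUnion, mem_range] at hx ⊢
    obtain ⟨b, hb, j, rfl⟩ := hx
    exact ⟨b, hb, j + 1, Function.iterate_succ_apply' f j b⟩
  · rintro b ⟨k, hk⟩
    by_cases hper : b ∈ Function.periodicPts f
    · left
      obtain ⟨m, hm, hmb⟩ := hper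
      simp only [mem_iUnion, mem_range]
      refine ⟨f^[k] b, ⟨hk, m, hm, hmb.apply_iterate k⟩, m * k - k, ?_⟩
      rw [← Function.iterate_add_apply, Nat.sub_add_cancel (Nat.le_mul_of_pos_left k hm)]
      exact hmb.mul_const k
    · right
      have key : ∀ i j, i < j → f^[i] b ≠ f^[j] b := by
        intro i j hij h
        refine hper ⟨j - i, by omega, hf.iterate i ?_⟩
        rw [← Function.iterate_add_apply, Nat.add_sub_cancel' hij.le, h]
      intro i j hij
      rcases lt_trichotomy i j with h | h | h
      · exact absurd hij (key i j h)
      · exact h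
      · exact absurd hij.symm (key j i h)

universe u

/-- Regularity provides a finite code separating points at distance at least `ε` and locally
constant off a finite set. -/
theorem IsRegularCurve.exists_code {X : Type u} [PseudoMetricSpace X] [CompactSpace X]
    (hX : IsRegularCurve X) {ε : ℝ} (hε : 0 < ε) :
    ∃ (α : Type u) (_ : Fintype α) (_ : Nonempty α) (c : X → α) (B : Finset X),
      (∀ x y, c x = c y → dist x y < ε) ∧ ∀ x ∉ B, ∀ᶠ y in 𝓝 x, c y = c x := by
  classical
  choose U hUo hxU hUb hUf using fun x : X =>
    hX x (Metric.ball x (ε / 2)) Metric.isOpen_ball (Metric.mem_ball_self (half_pos hε))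
  obtain ⟨t, ht⟩ := isCompact_univ.elim_finite_subcover U hUo
    fun x _ => mem_iUnion.2 ⟨x, hxU x⟩
  refine ⟨t → Prop, inferInstance, inferInstance, fun y i => y ∈ U i,
    t.biUnion fun i => (hUf i).toFinset, fun x y hxy => ?_, fun x hx => ?_⟩
  · obtain ⟨i, hi, hxi⟩ := mem_iUnion₂.1 (ht (mem_univ x))
    have hyi : y ∈ U i := (congrFun hxy ⟨i, hi⟩).mp hxi
    have h1 := Metric.mem_ball.1 (hUb i hxi)
    have h2 := Metric.mem_ball'.1 (hUb i hyi)
    linarith [dist_triangle x i y]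
  · have key : ∀ i : t, ∀ᶠ y in 𝓝 x, (y ∈ U i) = (x ∈ U i) := by
      rintro ⟨i, hi⟩
      by_cases hxi : x ∈ U i
      · filter_upwards [(hUo i).mem_nhds hxi] with y hy
        simp [hy, hxi]
      · have hcl : x ∉ closure (U i) := fun h => hx <| by
          simp only [Finset.mem_biUnion, Finite.mem_toFinset]
          exact ⟨i, hi, h, by rwa [(hUo i).interior_eq]⟩
        filter_upwards [isClosed_closure.isOpen_compl.mem_nhds hcl] with y hy
        have : y ∉ U i := fun h => hy (subset_closure h)
        simp [this, hxi]
    filter_upwards [eventually_all.2 key] with y hy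
    exact funext hy

/-- A finite forward invariant set in a regular curve has a neighbourhood with finite boundary
such that an orbit segment in it is shadowed by an orbit of the invariant set. -/
theorem IsRegularCurve.exists_shadowing_nhds {X : Type*} [MetricSpace X]
    (hX : IsRegularCurve X) {f : X → X} (hf : Continuous f) {Q : Set X} (hQ : Q.Finite)
    (hfQ : MapsTo f Q Q) {ε : ℝ} (hε : 0 < ε) :
    ∃ V : Set X, IsOpen V ∧ Q ⊆ V ∧ (frontier V).Finite ∧
      ∀ n x, 0 < n → (∀ k < n, f^[k] x ∈ V) →
        ∃ q ∈ Q, ∀ k < n, dist (f^[k] x) (f^[k] q) < ε := by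
  obtain ⟨W, hW, hdisj⟩ := hQ.t2_separation
  choose V hVo hxV hVW hVf using fun q : X =>
    hX q ((W q ∩ Metric.ball q ε) ∩ f ⁻¹' W (f q))
      (((hW q).2.inter Metric.isOpen_ball).inter ((hW (f q)).2.preimage hf))
      ⟨⟨(hW q).1, Metric.mem_ball_self hε⟩, (hW (f q)).1⟩
  have hVopen : IsOpen (⋃ q ∈ Q, V q) := isOpen_biUnion fun q _ => hVo q
  refine ⟨⋃ q ∈ Q, V q, hVopen, fun q hq => mem_biUnion hq (hxV q), ?_, ?_⟩
  · refine (hQ.biUnion fun q _ => hVf q).subset ?_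
    rintro x ⟨hx, hx'⟩
    rw [hVopen.interior_eq] at hx'
    rw [hQ.closure_biUnion] at hx
    obtain ⟨q, hq, hxq⟩ := mem_iUnion₂.1 hx
    refine mem_biUnion hq ⟨hxq, fun h => hx' (mem_biUnion hq (interior_subset h))⟩
  · intro n x hn hx
    obtain ⟨q, hq, hxq⟩ := mem_iUnion₂.1 (hx 0 hn)
    have key : ∀ k < n, f^[k] x ∈ V (f^[k] q) := by
      intro k
      induction k with
      | zero => exact fun _ => hxq
      | succ k ih =>
        intro hk
        obtain ⟨q', hq', hxq'⟩ := mem_iUnion₂.1 (hx (k + 1) hk)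
        have h1 := (hVW _ (ih (by omega))).2
        rw [mem_preimage, ← Function.iterate_succ_apply' f, ← Function.iterate_succ_apply' f] at h1
        have heq : q' = f^[k + 1] q := by
          by_contra hne
          exact (hdisj hq' (hfQ.iterate (k + 1) hq) hne).le_bot ⟨(hVW _ hxq').1.1, h1⟩
        rwa [← heq]
    exact ⟨q, hq, fun k hk => Metric.mem_ball.1 (hVW _ (key k hk)).1.2⟩

section Atoms

variable {α : Type*} [TopologicalSpace X] {f : X → X} {c : X → α} {B : Finset X}

/-- The itinerary of `x` during the first `n` steps, as read by the code `c`. -/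
def itinerary (f : X → X) (c : X → α) (n : ℕ) (x : X) : Fin n → α := fun k => c (f^[k] x)

/-- The points with the same itinerary as `x` whose first `n` iterates avoid `B`. -/
def atom (f : X → X) (c : X → α) (B : Finset X) (n : ℕ) (x : X) : Set X :=
  {y | (∀ k < n, f^[k] y ∉ B) ∧ itinerary f c n y = itinerary f c n x}

theorem isOpen_atom [T1Space X] (hf : Continuous f)
    (hc : ∀ x ∉ B, ∀ᶠ y in 𝓝 x, c y = c x) (n : ℕ) (x : X) : IsOpen (atom f c B n x) := by
  rw [isOpen_iff_mem_nhds]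
  rintro y ⟨hyB, hyx⟩
  have key : ∀ k : Fin n, ∀ᶠ z in 𝓝 y, f^[k] z ∉ B ∧ c (f^[k] z) = c (f^[k] y) := fun k =>
    ((hf.iterate k).tendsto y).eventually
      ((B.finite_toSet.isClosed.isOpen_compl.eventually_mem (hyB k k.2)).and (hc _ (hyB k k.2)))
  filter_upwards [eventually_all.2 key] with z hz
  exact ⟨fun k hk => (hz ⟨k, hk⟩).1, (funext fun k => (hz k).2 : itinerary f c n z = _).trans hyx⟩

theorem itinerary_apply_eq_of_mem_closure_atom (hf : Continuous f)
    (hc : ∀ x ∉ B, ∀ᶠ y in 𝓝 x, c y = c x) {n : ℕ} {x b : X} (hb : b ∈ closure (atom f c B n x))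
    (k : Fin n) (hk : f^[k] b ∉ B) : itinerary f c n x k = c (f^[k] b) := by
  obtain ⟨y, hy, hyA⟩ := ((mem_closure_iff_frequently.1 hb).and_eventually
    (((hf.iterate k).tendsto b).eventually (hc _ hk))).exists
  rw [← hy.2]
  exact hyA

/-- If every limit point of an atom outside of it lies in a forward invariant set `Q`, and `V` is a
neighbourhood of `Q`, then the atom meets the `k`-th preimage of the boundary of `V`, unless it is
the whole space or is carried by `f^[k]` into `V`. -/
theorem exists_mem_frontier_of_closure_atom_subset [T1Space X] [PreconnectedSpace X]
    (hf : Continuous f) (hc : ∀ x ∉ B, ∀ᶠ y in 𝓝 x, c y = c x) {n : ℕ} {x : X} {Q V : Set X}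
    (hfQ : MapsTo f Q Q) (hV : IsOpen V) (hQV : Q ⊆ V)
    (hQ : closure (atom f c B n x) ⊆ atom f c B n x ∪ Q) (huniv : atom f c B n x ≠ univ)
    (hx : x ∈ atom f c B n x) {k : ℕ} (hk : f^[k] x ∉ V) :
    ∃ y ∈ atom f c B n x, f^[k] y ∈ frontier V := by
  by_contra! hcon
  have hopen := isOpen_atom hf hc n x
  have hfk := hf.iterate k
  have hclosed : IsClosed (atom f c B n x ∩ (f^[k] ⁻¹' V)ᶜ) := by
    have : atom f c B n x ∩ (f^[k] ⁻¹' V)ᶜ = closure (atom f c B n x) ∩ (f^[k] ⁻¹' V)ᶜ := by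
      refine (inter_subset_inter_left _ subset_closure).antisymm ?_
      rintro y ⟨hy, hyV⟩
      exact ⟨(hQ hy).resolve_right fun h => hyV (hQV (hfQ.iterate k h)), hyV⟩
    rw [this]
    exact isClosed_closure.inter (hV.preimage hfk).isClosed_compl
  have hopen' : IsOpen (atom f c B n x ∩ (f^[k] ⁻¹' V)ᶜ) := by
    have : atom f c B n x ∩ (f^[k] ⁻¹' V)ᶜ = atom f c B n x ∩ f^[k] ⁻¹' (closure V)ᶜ := by
      ext y
      refine and_congr_right fun hy => not_congr ⟨fun h => subset_closure h, fun h => ?_⟩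
      by_contra hyV
      exact hcon y hy ⟨h, by rwa [hV.interior_eq]⟩
    rw [this]
    exact hopen.inter (isClosed_closure.isOpen_compl.preimage hfk)
  have := IsClopen.eq_univ ⟨hclosed, hopen'⟩ ⟨x, hx, hk⟩
  exact huniv (univ_subset_iff.1 (this ▸ inter_subset_left))

end Atoms

/-- The separation numbers of an injective continuous self-map of a regular curve grow at most
linearly. -/
theorem IsRegularCurve.exists_sepCount_le_mul {X : Type*} [MetricSpace X] [CompactSpace X]
    [PreconnectedSpace X] (hX : IsRegularCurve X) {f : X → X} (hf : Continuous f)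
    (hinj : Function.Injective f) {ε : ℝ} (hε : 0 < ε) :
    ∃ C : ℕ, ∀ n, 0 < n → sepCount f n ε ≤ ((C * n : ℕ) : ℕ∞) := by
  classical
  obtain ⟨α, _, _, c, B, hcε, hc⟩ := hX.exists_code hε
  obtain ⟨Q, hQfin, hfQ, hBQ⟩ := exists_finite_mapsTo_or_injective_iterate hinj B
  obtain ⟨V, hVo, hQV, hVf, hVshadow⟩ :=
    hX.exists_shadowing_nhds hf hQfin hfQ (half_pos hε)
  set F := hVf.toFinset
  set R := Fintype.card α ^ B.card
  refine ⟨1 + B.card + B.card * R + F.card + hQfin.toFinset.card, fun n hn => ?_⟩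
  refine iSup₂_le fun E hE => Nat.cast_le.2 ?_
  have hsep : ∀ x ∈ E, ∀ y ∈ E, (∀ k < n, dist (f^[k] x) (f^[k] y) < ε) → x = y := by
    intro x hx y hy h
    by_contra hne
    exact (dynDist_lt hε h).not_ge (hE x hx y hy hne)
  have hitin : ∀ x ∈ E, ∀ y ∈ E, itinerary f c n x = itinerary f c n y → x = y :=
    fun x hx y hy h => hsep x hx y hy fun k hk => hcε _ _ (congrFun h ⟨k, hk⟩)
  have hitinOn {s : Finset X} (hs : s ⊆ E) : InjOn (itinerary f c n) s :=
    fun x hx y hy h => hitin x (hs hx) y (hs hy) h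
  by_cases huniv : ∃ x, atom f c B n x = univ
  · obtain ⟨x, hx⟩ := huniv
    have h1 : E.card ≤ 1 := Finset.card_le_one.2 fun y hy z hz => hitin y hy z hz <|
      ((hx ▸ mem_univ y : y ∈ atom f c B n x).2).trans
        ((hx ▸ mem_univ z : z ∈ atom f c B n x).2).symm
    exact h1.trans (Nat.mul_pos (by omega) hn)
  push Not at huniv
  set P := hittingPoints hinj B n
  set words := (P.filter fun b => Function.Injective fun k => f^[k] b).biUnion
    (compatibleWords f c B n)
  set E₁ := E.filter fun x => x ∈ P
  set E₂ := E.filter fun x => itinerary f c n x ∈ words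
  set E₃ := E.filter fun x => itinerary f c n x ∈
    (hittingPoints hinj F n).image (itinerary f c n)
  set E₄ := E.filter fun x => ∃ q ∈ hQfin.toFinset, ∀ k < n, dist (f^[k] x) (f^[k] q) < ε / 2
  have hcover : E ⊆ ((E₁ ∪ E₂) ∪ E₃) ∪ E₄ := by
    intro x hxE
    by_contra hx
    simp only [E₁, E₂, E₃, E₄, Finset.mem_union, Finset.mem_filter, hxE, true_and, not_or] at hx
    obtain ⟨⟨⟨hx₁, hx₂⟩, hx₃⟩, hx₄⟩ := hx
    have hxA : x ∈ atom f c B n x :=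
      ⟨fun k hk h => hx₁ ((mem_hittingPoints hinj).2 ⟨k, hk, h⟩), rfl⟩
    have hQ : closure (atom f c B n x) ⊆ atom f c B n x ∪ Q := by
      intro b hb
      have hbw := itinerary_apply_eq_of_mem_closure_atom hf hc hb
      by_cases hbP : b ∈ P
      · obtain ⟨k, -, hk⟩ := (mem_hittingPoints hinj).1 hbP
        refine Or.inr ((hBQ b ⟨k, hk⟩).resolve_right fun hbinj => hx₂ ?_)
        exact Finset.mem_biUnion.2 ⟨b, Finset.mem_filter.2 ⟨hbP, hbinj⟩,
          mem_compatibleWords.2 hbw⟩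
      · have hbB : ∀ k < n, f^[k] b ∉ B :=
          fun k hk h => hbP ((mem_hittingPoints hinj).2 ⟨k, hk, h⟩)
        exact Or.inl ⟨hbB, funext fun k => (hbw k (hbB k k.2)).symm⟩
    by_cases hstay : ∀ k < n, f^[k] x ∈ V
    · obtain ⟨q, hq, h⟩ := hVshadow n x hn hstay
      exact hx₄ ⟨q, hQfin.mem_toFinset.2 hq, h⟩
    · push Not at hstay
      obtain ⟨k, hk, hkV⟩ := hstay
      obtain ⟨y, hy, hyV⟩ := exists_mem_frontier_of_closure_atom_subset hf hc hfQ hVo hQV hQ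
        (huniv x) hxA hkV
      exact hx₃ (Finset.mem_image.2 ⟨y, (mem_hittingPoints hinj).2
        ⟨k, hk, hVf.mem_toFinset.2 hyV⟩, hy.2⟩)
  have hP : P.card ≤ n * B.card := card_hittingPoints_le hinj B n
  have h₁ : E₁.card ≤ n * B.card :=
    (Finset.card_le_card fun x hx => (Finset.mem_filter.1 hx).2).trans hP
  have h₂ : E₂.card ≤ n * B.card * R := by
    refine (Finset.card_le_card_of_injOn (t := words) _
      (fun x hx => (Finset.mem_filter.1 hx).2) (hitinOn (Finset.filter_subset _ _))).trans ?_
    refine (Finset.card_biUnion_le_card_mul _ _ R fun b hb =>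
      card_compatibleWords_le c B n (Finset.mem_filter.1 hb).2).trans ?_
    exact Nat.mul_le_mul_right _ ((Finset.card_filter_le _ _).trans hP)
  have h₃ : E₃.card ≤ n * F.card :=
    ((Finset.card_le_card_of_injOn _ (fun x hx => (Finset.mem_filter.1 hx).2)
      (hitinOn (Finset.filter_subset _ _))).trans Finset.card_image_le).trans
      (card_hittingPoints_le hinj F n)
  have h₄ : E₄.card ≤ hQfin.toFinset.card := by
    refine Finset.card_le_card_of_forall_subsingleton
      (fun x q => ∀ k < n, dist (f^[k] x) (f^[k] q) < ε / 2)
      (fun x hx => (Finset.mem_filter.1 hx).2) fun q _ x hx y hy => ?_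
    refine hsep x (Finset.mem_filter.1 hx.1).1 y (Finset.mem_filter.1 hy.1).1 fun k hk => ?_
    linarith [dist_triangle_right (f^[k] x) (f^[k] y) (f^[k] q), hx.2 k hk, hy.2 k hk]
  have hcard := Finset.card_le_card hcover
  have hu₁ := Finset.card_union_le ((E₁ ∪ E₂) ∪ E₃) E₄
  have hu₂ := Finset.card_union_le (E₁ ∪ E₂) E₃
  have hu₃ := Finset.card_union_le E₁ E₂
  have h₅ : hQfin.toFinset.card ≤ hQfin.toFinset.card * n := Nat.le_mul_of_pos_right _ hn
  calc E.card ≤ n * B.card + n * B.card * R + n * F.card + hQfin.toFinset.card * n := by omega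
    _ ≤ _ := by ring_nf; omega

/-- a homeomorphism of a regular curve has polynomial entropy at most `1`. -/
theorem hpol_le_one_of_isHomeomorph_of_isRegularCurve
    {X : Type*} [MetricSpace X] [CompactSpace X] [ConnectedSpace X] [Nonempty X]
    (hX : IsRegularCurve X) (f : X → X) (hf : IsHomeomorph f) :
    hpol f ≤ 1 := by
  refine iSup₂_le fun ε hε => ?_
  obtain ⟨C, hC⟩ := hX.exists_sepCount_le_mul hf.continuous hf.injective hε
  exact polGrowth_le_one_of_le_mul C hC
end

section
/- Let X be a regular curve and f : X → X a homeomorphism possessing at least one wandering point. Then the polynomial entropy of f equals 1. -/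
open Filter Topology TopologicalSpace Set
open scoped ENNReal NNReal

variable {X : Type*}

/-- A wandering point: some open neighbourhood `U` of `p` satisfies `f^n(U) ∩ U = ∅` for all
`n ≥ 1`. -/
def IsWanderingPoint [TopologicalSpace X] (f : X → X) (p : X) : Prop :=
  ∃ U : Set X, IsOpen U ∧ p ∈ U ∧ ∀ n : ℕ, 1 ≤ n → f^[n] '' U ∩ U = ∅

section DynDist

variable [PseudoMetricSpace X] {f : X → X} {n : ℕ} {ε : ℝ}

theorem dist_iterate_le_dynDist {k : ℕ} (hk : k < n) (x y : X) :
    dist (f^[k] x) (f^[k] y) ≤ dynDist f n x y := by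
  have h := Finset.le_sup (f := fun k => nndist (f^[k] x) (f^[k] y)) (Finset.mem_range.2 hk)
  exact_mod_cast h

theorem dynDist_lt_of_forall_dist_lt (hε : 0 < ε) {x y : X}
    (h : ∀ k < n, dist (f^[k] x) (f^[k] y) < ε) : dynDist f n x y < ε := by
  lift ε to ℝ≥0 using hε.le
  rw [dynDist, NNReal.coe_lt_coe, Finset.sup_lt_iff (by exact_mod_cast hε)]
  intro k hk
  exact_mod_cast h k (Finset.mem_range.1 hk)

/-- A set that `ε / 4`-spans bounds the size of `(n, ε)`-separated sets. -/
theorem sepCount_le_card_of_spanning (hε : 0 < ε) (S : Finset X)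
    (hS : ∀ x, ∃ c ∈ S, ∀ k < n, dist (f^[k] x) (f^[k] c) ≤ ε / 4) :
    sepCount f n ε ≤ S.card := by
  refine iSup₂_le fun E hE => ?_
  choose c hcS hc using hS
  refine Nat.cast_le.2 (Finset.card_le_card_of_injOn c (fun x _ => hcS x) ?_)
  intro x hx y hy hxy
  by_contra hne
  refine (hE x hx y hy hne).not_gt (dynDist_lt_of_forall_dist_lt hε fun k hk => ?_)
  have h₁ := hc x k hk
  have h₂ := hc y k hk
  rw [← hxy] at h₂
  linarith [dist_triangle_right (f^[k] x) (f^[k] y) (f^[k] (c x))]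

end DynDist

/-- In a connected space, a point can be moved to a point on the boundaries of a finite family of
open sets (or to any given point, if there are no boundary points) without leaving the closures of
the members of the family that contain it. -/
theorem exists_mem_insert_iUnion_frontier [TopologicalSpace X] [PreconnectedSpace X]
    {ι : Type*} [Finite ι] {W : ι → Set X} (hW : ∀ i, IsOpen (W i)) (x₀ x : X) :
    ∃ c ∈ insert x₀ (⋃ i, frontier (W i)), ∀ i, x ∈ W i → c ∈ closure (W i) := by
  set G : Set X := ⋂ i : {i // x ∈ W i}, W i
  have hGW (i) (hi : x ∈ W i) : closure G ⊆ closure (W i) :=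
    closure_mono (iInter_subset (fun i : {i // x ∈ W i} => W i) ⟨i, hi⟩)
  by_cases h : ∃ c ∈ closure G, c ∈ ⋃ i, frontier (W i)
  · obtain ⟨c, hcG, hc⟩ := h
    exact ⟨c, mem_insert_of_mem _ hc, fun i hi => hGW i hi hcG⟩
  · push Not at h
    have hclosed : IsClosed G := by
      refine isClosed_of_closure_subset fun y hy => mem_iInter.2 fun ⟨i, hi⟩ => ?_
      by_contra hyi
      refine h y hy (mem_iUnion.2 ⟨i, hGW i hi hy, ?_⟩)
      rwa [(hW i).interior_eq]
    have hG : G = univ := IsClopen.eq_univ ⟨hclosed, isOpen_iInter_of_finite fun i => hW i⟩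
      ⟨x, mem_iInter.2 fun i => i.2⟩
    refine ⟨x₀, mem_insert _ _, fun i hi => hGW i hi (subset_closure ?_)⟩
    rw [hG]
    exact mem_univ x₀

/-- The separation numbers of an injective continuous self-map of a regular curve grow at most
linearly. -/
theorem exists_sepCount_le_mul_add_one [MetricSpace X] [CompactSpace X] [ConnectedSpace X]
    (hX : IsRegularCurve X) {f : X → X} (hf : Continuous f) (hinj : f.Injective) {ε : ℝ}
    (hε : 0 < ε) : ∃ m : ℕ, ∀ n, sepCount f n ε ≤ (n * m + 1 : ℕ) := by
  choose V hVo hxV hVb hVf using fun x : X =>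
    hX x (Metric.ball x (ε / 8)) Metric.isOpen_ball (Metric.mem_ball_self (by positivity))
  obtain ⟨T, hT⟩ := isCompact_univ.elim_finite_subcover V hVo
    fun x _ => mem_iUnion.2 ⟨x, hxV x⟩
  classical
  obtain ⟨x₀⟩ : Nonempty X := inferInstance
  set F : Finset X := T.biUnion fun v => (hVf v).toFinset with hF
  refine ⟨F.card, fun n => ?_⟩
  set S : Finset X := insert x₀
    ((Finset.range n).biUnion fun k => F.preimage f^[k] (hinj.iterate k).injOn) with hS
  have hcard : S.card ≤ n * F.card + 1 := by
    refine (Finset.card_insert_le _ _).trans (Nat.succ_le_succ ?_)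
    refine (Finset.card_biUnion_le_card_mul _ _ F.card fun k _ => ?_).trans_eq (by simp)
    exact Finset.card_le_card_of_injOn f^[k] (fun x hx => Finset.mem_preimage.1 hx)
      (hinj.iterate k).injOn
  refine (sepCount_le_card_of_spanning hε S fun x => ?_).trans (Nat.cast_le.2 hcard)
  obtain ⟨c, hc, hcx⟩ := exists_mem_insert_iUnion_frontier
    (W := fun i : T × Fin n => f^[i.2] ⁻¹' V i.1)
    (fun i => (hVo i.1).preimage (hf.iterate i.2)) x₀ x
  refine ⟨c, ?_, fun k hk => ?_⟩
  · rw [hS, Finset.mem_insert]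
    refine hc.imp_right fun hc => ?_
    obtain ⟨⟨v, k⟩, hvk⟩ := mem_iUnion.1 hc
    simp only [hF, Finset.mem_biUnion, Finset.mem_range, Finset.mem_preimage, Finite.mem_toFinset]
    exact ⟨k, k.2, v, v.2, (hf.iterate k).frontier_preimage_subset _ hvk⟩
  · obtain ⟨v, hvT, hxv⟩ : ∃ v ∈ T, f^[k] x ∈ V v := by simpa using hT (mem_univ (f^[k] x))
    have hcv : f^[k] c ∈ closure (V v) :=
      (hf.iterate k).closure_preimage_subset _ (hcx (⟨v, hvT⟩, ⟨k, hk⟩) hxv)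
    have h₁ := Metric.mem_ball.1 (hVb v hxv)
    have h₂ := Metric.mem_closedBall.1
      (Metric.closure_ball_subset_closedBall (closure_mono (hVb v) hcv))
    linarith [dist_triangle_right (f^[k] x) (f^[k] c) v]

/-- The separation numbers of a surjective map with a wandering point grow at least linearly. -/
theorem exists_le_sepCount [PseudoMetricSpace X] {f : X → X} (hf : f.Surjective) {p : X}
    (hp : IsWanderingPoint f p) : ∃ ε > 0, ∀ n : ℕ, (n : ℕ∞) ≤ sepCount f n ε := by
  obtain ⟨U, hU, hpU, hUf⟩ := hp
  obtain ⟨ε, hε, hεU⟩ := Metric.isOpen_iff.1 hU p hpU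
  refine ⟨ε, hε, fun n => ?_⟩
  obtain ⟨g, hg⟩ := hf.hasRightInverse
  have hgk (k : ℕ) : f^[k] (g^[k] p) = p := hg.iterate k p
  have hfar (n) {j k : ℕ} (hj : j < n) (hjk : j < k) :
      ε ≤ dynDist f n (g^[j] p) (g^[k] p) := by
    refine le_trans ?_ (dist_iterate_le_dynDist hj _ _)
    rw [hgk]
    by_contra! hlt
    have hkj : f^[k - j] (f^[j] (g^[k] p)) = p := by
      rw [← Function.iterate_add_apply, Nat.sub_add_cancel hjk.le, hgk]
    have hmem : p ∈ f^[k - j] '' U ∩ U :=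
      ⟨⟨_, hεU (by rwa [Metric.mem_ball, dist_comm]), hkj⟩, hpU⟩
    rwa [hUf (k - j) (by omega)] at hmem
  have hcomm (n) (x y : X) : dynDist f n x y = dynDist f n y x := by
    simp only [dynDist, nndist_comm]
  have hsep (n) {j k : ℕ} (hj : j < n) (hk : k < n) (hjk : j ≠ k) :
      ε ≤ dynDist f n (g^[j] p) (g^[k] p) := by
    rcases hjk.lt_or_gt with h | h
    · exact hfar n hj h
    · rw [hcomm]
      exact hfar n hk h
  have hinj : InjOn (fun k => g^[k] p) (Finset.range n : Set ℕ) := by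
    intro j hj k hk hjk
    by_contra hne
    have h := hsep n (Finset.mem_range.1 hj) (Finset.mem_range.1 hk) hne
    have hjk' : g^[j] p = g^[k] p := hjk
    rw [hjk'] at h
    exact h.not_gt (dynDist_lt_of_forall_dist_lt hε fun i _ => by rwa [dist_self])
  classical
  have hE : IsDynSeparated f n ε ((Finset.range n).image fun k => g^[k] p : Finset X) := by
    intro x hx y hy hxy
    obtain ⟨j, hj, rfl⟩ := Finset.mem_image.1 hx
    obtain ⟨k, hk, rfl⟩ := Finset.mem_image.1 hy
    exact hsep n (Finset.mem_range.1 hj) (Finset.mem_range.1 hk) fun h => hxy (by rw [h])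
  refine le_trans ?_ (le_iSup₂_of_le _ hE le_rfl)
  rw [Finset.card_image_of_injOn hinj, Finset.card_range]

theorem polGrowth_le_one {u : ℕ → ℕ∞} {m : ℕ} (hu : ∀ n, u n ≤ (n * m + 1 : ℕ)) :
    polGrowth u ≤ 1 := by
  have hlog : Tendsto (fun n : ℕ => Real.log n) atTop atTop :=
    Real.tendsto_log_atTop.comp tendsto_natCast_atTop_atTop
  have hlim : Tendsto (fun n : ℕ => ENNReal.ofReal (1 + Real.log (m + 1 : ℕ) / Real.log n))
      atTop (𝓝 1) := by
    have h := ENNReal.tendsto_ofReal ((hlog.const_div_atTop (Real.log (m + 1 : ℕ))).const_add 1)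
    simpa using h
  rw [← hlim.limsup_eq]
  refine limsup_le_limsup ?_
  filter_upwards [eventually_ge_atTop 2] with n hn
  have hlt : u n ≠ ⊤ := ne_top_of_le_ne_top (ENat.natCast_ne_top _) (hu n)
  rw [if_neg hlt]
  refine ENNReal.ofReal_le_ofReal ?_
  have hlogn : 0 < Real.log n := Real.log_pos (by exact_mod_cast hn)
  have hn0 : (n : ℝ) ≠ 0 := by positivity
  rw [div_le_iff₀ hlogn, add_mul, div_mul_cancel₀ _ hlogn.ne', one_mul,
    ← Real.log_mul hn0 (by positivity), ← Nat.cast_mul]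
  have hle : (u n).toNat ≤ n * (m + 1) := by
    have h := ENat.toNat_le_toNat (hu n) (ENat.natCast_ne_top _)
    rw [ENat.toNat_natCast] at h
    nlinarith
  rcases Nat.eq_zero_or_pos (u n).toNat with h0 | h0
  · rw [h0]
    simpa using Real.log_natCast_nonneg (n * (m + 1))
  · exact Real.log_le_log (by exact_mod_cast h0) (by exact_mod_cast hle)

theorem one_le_polGrowth {u : ℕ → ℕ∞} (hu : ∀ n : ℕ, (n : ℕ∞) ≤ u n) : 1 ≤ polGrowth u := by
  rw [← limsup_const (f := (atTop : Filter ℕ)) (1 : ℝ≥0∞)]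
  refine limsup_le_limsup ?_
  filter_upwards [eventually_ge_atTop 2] with n hn
  split_ifs with h
  · exact le_top
  · have hlogn : 0 < Real.log n := Real.log_pos (by exact_mod_cast hn)
    rw [ENNReal.one_le_ofReal, one_le_div hlogn]
    refine Real.log_le_log (by positivity) ?_
    have h := ENat.toNat_le_toNat (hu n) h
    rw [ENat.toNat_natCast] at h
    exact_mod_cast h

/-- a homeomorphism of a regular curve possessing a wandering point has
polynomial entropy equal to `1`. -/
theorem hpol_eq_one_of_isHomeomorph_of_isRegularCurve_of_wandering
    {X : Type*} [MetricSpace X] [CompactSpace X] [ConnectedSpace X] [Nonempty X]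
    (hX : IsRegularCurve X) (f : X → X) (hf : IsHomeomorph f)
    (p : X) (hp : IsWanderingPoint f p) :
    hpol f = 1 := by
  refine le_antisymm (iSup₂_le fun ε hε => ?_) ?_
  · obtain ⟨m, hm⟩ := exists_sepCount_le_mul_add_one hX hf.continuous hf.injective hε
    exact polGrowth_le_one hm
  · obtain ⟨ε, hε, h⟩ := exists_le_sepCount hf.surjective hp
    exact le_iSup₂_of_le ε hε (one_le_polGrowth h)
end
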